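/- arXiv:2209.00035 — 12 statements merged into one kernel-verified Lean document; each statement's English description precedes it below -/
import Mathlib

section
/- Let s ∈ ℝ and θ ∈ (−π, π), and set λ = tan(θ/2). Then in SL(2,ℝ) the identity δ(s)·r(θ)·δ(−s) = r(θ')·δ(s')·τ(t') holds, where θ' = 2·arctan(e^{−s}λ), s' = log((1 + e^{−2s}λ²)/(1 + λ²)), and t' = 2·sinh(s)·λ/(1 + e^{−2s}λ²). -/
open Real

/-- Rotation one-parameter subgroup of SL(2,ℝ). -/
noncomputable def rotMat (θ : ℝ) : Matrix (Fin 2) (Fin 2) ℝ :=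
  !![Real.cos (θ / 2), Real.sin (θ / 2); -Real.sin (θ / 2), Real.cos (θ / 2)]

/-- Dilation one-parameter subgroup of SL(2,ℝ). -/
noncomputable def dilMat (s : ℝ) : Matrix (Fin 2) (Fin 2) ℝ :=
  !![Real.exp (s / 2), 0; 0, Real.exp (-s / 2)]

/-- Translation one-parameter subgroup of SL(2,ℝ). -/
def transMat (t : ℝ) : Matrix (Fin 2) (Fin 2) ℝ :=
  !![1, t; 0, 1]

/-- Conjugating a rotation by a dilation rescales the off-diagonal entries. -/
lemma dilMat_mul_rotMat_mul_dilMat_neg (s θ : ℝ) :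
    dilMat s * rotMat θ * dilMat (-s) =
      !![cos (θ / 2), exp s * sin (θ / 2); -(exp (-s) * sin (θ / 2)), cos (θ / 2)] := by
  have h₁ : exp (s / 2) * exp (-s / 2) = 1 := by rw [← exp_add]; simp [neg_div]
  have h₂ : exp (s / 2) * exp (s / 2) = exp s := by rw [← exp_add, add_halves]
  have h₃ : exp (-s / 2) * exp (-s / 2) = exp (-s) := by rw [← exp_add, add_halves]
  ext i j
  fin_cases i <;> fin_cases j <;>
    simp [dilMat, rotMat, Matrix.mul_apply, Fin.sum_univ_two]
  · linear_combination cos (θ / 2) * h₁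
  · linear_combination sin (θ / 2) * h₂
  · linear_combination sin (θ / 2) * h₃
  · linear_combination cos (θ / 2) * h₁

lemma dilMat_log {q : ℝ} (hq : 0 < q) : dilMat (log q) = !![√q, 0; 0, (√q)⁻¹] := by
  have h : exp (log q / 2) = √q := by rw [← log_sqrt hq.le, exp_log (sqrt_pos.2 hq)]
  rw [dilMat, neg_div, exp_neg, h]

lemma rotMat_two_mul_arctan (x : ℝ) :
    rotMat (2 * arctan x) =
      !![1 / √(1 + x ^ 2), x / √(1 + x ^ 2); -(x / √(1 + x ^ 2)), 1 / √(1 + x ^ 2)] := by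
  rw [rotMat, mul_div_cancel_left₀ _ two_ne_zero, cos_arctan, sin_arctan]

theorem stmt0 (s θ : ℝ) (hθ : θ ∈ Set.Ioo (-Real.pi) Real.pi)
    (lam : ℝ) (hlam : lam = Real.tan (θ / 2)) :
    dilMat s * rotMat θ * dilMat (-s) =
      rotMat (2 * Real.arctan (Real.exp (-s) * lam)) *
        dilMat (Real.log ((1 + Real.exp (-2 * s) * lam ^ 2) / (1 + lam ^ 2))) *
        transMat (2 * Real.sinh s * lam / (1 + Real.exp (-2 * s) * lam ^ 2)) := by
  have harc : arctan lam = θ / 2 := by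
    rw [hlam, arctan_tan] <;> linarith [hθ.1, hθ.2]
  have hsq : exp (-2 * s) * lam ^ 2 = (exp (-s) * lam) ^ 2 := by
    rw [mul_pow, ← exp_nat_mul]; congr 2; push_cast; ring
  have hA : 0 < 1 + lam ^ 2 := by positivity
  have hB : 0 < 1 + (exp (-s) * lam) ^ 2 := by positivity
  rw [dilMat_mul_rotMat_mul_dilMat_neg, hsq, rotMat_two_mul_arctan, dilMat_log (div_pos hB hA),
    sqrt_div hB.le, ← harc, cos_arctan, sin_arctan, sinh_eq]
  have hE : exp s * exp (-s) = 1 := by rw [← exp_add, add_neg_cancel, exp_zero]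
  have hA' := sq_sqrt hA.le
  have hB' := sq_sqrt hB.le
  have hA₀ := (sqrt_pos.2 hA).ne'
  have hB₀ := (sqrt_pos.2 hB).ne'
  rw [← hB']
  simp only [sqrt_sq (sqrt_nonneg _)]
  generalize √(1 + lam ^ 2) = A at *
  generalize √(1 + (exp (-s) * lam) ^ 2) = B at *
  generalize exp s = E at *
  generalize exp (-s) = F at *
  ext i j
  fin_cases i <;> fin_cases j <;>
    simp [transMat, Matrix.mul_apply, Fin.sum_univ_two] <;> field_simp
  · linear_combination E * lam * hB' - lam * F * hA' + lam ^ 3 * F * hE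
  · linear_combination hB' - hA' + lam ^ 2 * hE
end

section
/- Let β > 0 and let B : ℝ → ℝ be differentiable. For λ ≠ 0 and x ∈ ℝ define A(λ,x) = (2π/β)·[−λ + ((1+λ²)/λ)·B(λ·(e^{2πx/β} − 1))]. Then A satisfies the partial differential equation ((λ² − 1)/(λ² + 1))·A(λ,x) + (β/2π)·(1 − e^{−2πx/β})·∂A/∂x(λ,x) = λ·∂A/∂λ(λ,x) + (4π/β)·λ/(λ² + 1) for all λ ≠ 0 and all x ∈ ℝ. -/
open Real

/-- The ansatz `A(λ,x)` built from an arbitrary function `B`. -/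
noncomputable def Aansatz (β : ℝ) (B : ℝ → ℝ) (lam x : ℝ) : ℝ :=
  (2 * π / β) * (-lam + ((1 + lam ^ 2) / lam) * B (lam * (Real.exp (2 * π * x / β) - 1)))

theorem hasDerivAt_Aansatz_right (β : ℝ) {B : ℝ → ℝ} (hB : Differentiable ℝ B) (lam x : ℝ) :
    HasDerivAt (fun y => Aansatz β B lam y)
      ((2 * π / β) * (((1 + lam ^ 2) / lam) *
        (deriv B (lam * (Real.exp (2 * π * x / β) - 1)) *
          (lam * (Real.exp (2 * π * x / β) * (2 * π / β)))))) x := by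
  have hlin : HasDerivAt (fun y : ℝ => 2 * π * y / β) (2 * π / β) x := by
    simpa using ((hasDerivAt_id x).const_mul (2 * π)).div_const β
  have hB' := (hB (lam * (Real.exp (2 * π * x / β) - 1))).hasDerivAt
  exact ((hB'.comp x ((hlin.exp.sub_const 1).const_mul lam)).const_mul _
    |>.const_add (-lam)).const_mul _

theorem hasDerivAt_Aansatz_left (β : ℝ) {B : ℝ → ℝ} (hB : Differentiable ℝ B) {lam : ℝ}
    (hlam : lam ≠ 0) (x : ℝ) :
    HasDerivAt (fun l => Aansatz β B l x)
      ((2 * π / β) * (-1 +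
        ((1 - 1 / lam ^ 2) * B (lam * (Real.exp (2 * π * x / β) - 1)) +
          ((1 + lam ^ 2) / lam) * (deriv B (lam * (Real.exp (2 * π * x / β) - 1)) *
            (Real.exp (2 * π * x / β) - 1))))) lam := by
  have hcoef : HasDerivAt (fun l : ℝ => (1 + l ^ 2) / l) (1 - 1 / lam ^ 2) lam := by
    refine (((hasDerivAt_pow 2 lam).const_add 1).div (hasDerivAt_id lam) hlam).congr_deriv ?_
    simp only [id]
    field_simp
    push_cast
    ring
  have hB' := (hB (lam * (Real.exp (2 * π * x / β) - 1))).hasDerivAt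
  have hu : HasDerivAt (fun l : ℝ => l * (Real.exp (2 * π * x / β) - 1))
      (Real.exp (2 * π * x / β) - 1) lam := by
    simpa using (hasDerivAt_id lam).mul_const (Real.exp (2 * π * x / β) - 1)
  exact ((hasDerivAt_id lam).neg.add (hcoef.mul (hB'.comp lam hu))).const_mul _

theorem stmt1 (β : ℝ) (hβ : 0 < β) (B : ℝ → ℝ) (hB : Differentiable ℝ B) :
    ∀ lam : ℝ, lam ≠ 0 → ∀ x : ℝ,
      ((lam ^ 2 - 1) / (lam ^ 2 + 1)) * Aansatz β B lam x
          + (β / (2 * π)) * (1 - Real.exp (-(2 * π * x / β)))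
            * deriv (fun y => Aansatz β B lam y) x
        = lam * deriv (fun l => Aansatz β B l x) lam
          + (4 * π / β) * lam / (lam ^ 2 + 1) := by
  intro lam hlam x
  rw [(hasDerivAt_Aansatz_right β hB lam x).deriv, (hasDerivAt_Aansatz_left β hB hlam x).deriv,
    Real.exp_neg, Aansatz]
  have hE := Real.exp_ne_zero (2 * π * x / β)
  generalize deriv B (lam * (Real.exp (2 * π * x / β) - 1)) = b'
  generalize B (lam * (Real.exp (2 * π * x / β) - 1)) = b
  generalize Real.exp (2 * π * x / β) = E at *
  have hβ' := hβ.ne'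
  have hπ := Real.pi_ne_zero
  have hsq : lam ^ 2 + 1 ≠ 0 := by positivity
  field_simp
  ring
end

section
/- Let f : ℝ → ℝ be continuously differentiable, let c ∈ ℝ, and for L > 0 set a = c − L/2, b = c + L/2, and S(L) = 2π·∫_a^b ((x − a)(b − x)/L)·f'(x)² dx. Then S is differentiable on (0,∞) and S'(L) = (π/2)·∫_{c−L/2}^{c+L/2} (1 + 4(x − c)²/L²)·f'(x)² dx ≥ 0; in particular the vacuum relative entropy of the interval is nondecreasing in the length L of the interval. -/
open Real intervalIntegral

/-- Vacuum relative entropy of the interval `(c - L/2, c + L/2)` for the coherent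
state generated by `f` in the U(1)-current model. -/
noncomputable def Svac (f : ℝ → ℝ) (c L : ℝ) : ℝ :=
  2 * π * ∫ x in (c - L / 2)..(c + L / 2),
    ((x - (c - L / 2)) * ((c + L / 2) - x) / L) * (deriv f x) ^ 2

/-- The integral of a continuous function over an interval centered at `c`, as a function of the
length of the interval, has the average of the two boundary values as its derivative. -/
theorem hasDerivAt_integral_centered {h : ℝ → ℝ} (hh : Continuous h) (c L : ℝ) :
    HasDerivAt (fun M : ℝ => ∫ x in (c - M / 2)..(c + M / 2), h x)
      ((h (c + L / 2) + h (c - L / 2)) / 2) L := by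
  have key (u : ℝ) : HasDerivAt (fun t : ℝ => ∫ x in c..t, h x) (h u) u :=
    hh.integral_hasStrictDerivAt c u |>.hasDerivAt
  have hhalf : HasDerivAt (fun M : ℝ => M / 2) (1 / 2) L := (hasDerivAt_id L).div_const 2
  have hb := (key (c + L / 2)).comp L (hhalf.const_add c)
  have ha := (key (c - L / 2)).comp L (hhalf.const_sub c)
  have hsub := hb.sub ha
  refine (hsub.congr_deriv (by ring)).congr_of_eventuallyEq (.of_forall fun M => ?_)
  exact (integral_interval_sub_left (hh.intervalIntegrable _ _) (hh.intervalIntegrable _ _)).symm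

/-- The entropy splits into integrals whose integrands do not depend on the length. -/
theorem Svac_eq_sub {f : ℝ → ℝ} (hg : Continuous (deriv f)) (c M : ℝ) :
    Svac f c M = 2 * π * (M / 4 * (∫ x in (c - M / 2)..(c + M / 2), (deriv f x) ^ 2) -
      M⁻¹ * ∫ x in (c - M / 2)..(c + M / 2), (x - c) ^ 2 * (deriv f x) ^ 2) := by
  rw [Svac]
  congr 1
  rw [← integral_const_mul, ← integral_const_mul, ← integral_sub
    (Continuous.intervalIntegrable (by fun_prop) _ _)
    (Continuous.intervalIntegrable (by fun_prop) _ _)]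
  refine integral_congr fun x _ => ?_
  rcases eq_or_ne M 0 with rfl | hM
  · simp
  · field_simp
    ring

theorem stmt2 (f : ℝ → ℝ) (hf : ContDiff ℝ 1 f) (c : ℝ) :
    ∀ L : ℝ, 0 < L →
      HasDerivAt (fun M => Svac f c M)
        ((π / 2) * ∫ x in (c - L / 2)..(c + L / 2),
          (1 + 4 * (x - c) ^ 2 / L ^ 2) * (deriv f x) ^ 2) L ∧
      0 ≤ (π / 2) * ∫ x in (c - L / 2)..(c + L / 2),
          (1 + 4 * (x - c) ^ 2 / L ^ 2) * (deriv f x) ^ 2 := by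
  intro L hL
  have hg : Continuous (deriv f) := hf.continuous_deriv le_rfl
  refine ⟨?_, mul_nonneg (by positivity)
    (integral_nonneg (by linarith) fun x _ => by positivity)⟩
  have hsplit : (∫ x in (c - L / 2)..(c + L / 2),
        (1 + 4 * (x - c) ^ 2 / L ^ 2) * (deriv f x) ^ 2) =
      (∫ x in (c - L / 2)..(c + L / 2), (deriv f x) ^ 2) +
        4 / L ^ 2 * ∫ x in (c - L / 2)..(c + L / 2), (x - c) ^ 2 * (deriv f x) ^ 2 := by
    rw [← integral_const_mul, ← integral_add
      (Continuous.intervalIntegrable (by fun_prop) _ _)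
      (Continuous.intervalIntegrable (by fun_prop) _ _)]
    refine integral_congr fun x _ => ?_
    ring
  have h₀ := hasDerivAt_integral_centered (h := fun x => (deriv f x) ^ 2) (by fun_prop) c L
  have h₂ := hasDerivAt_integral_centered (h := fun x => (x - c) ^ 2 * (deriv f x) ^ 2)
    (by fun_prop) c L
  have hS := (((((hasDerivAt_id L).div_const 4).mul h₀).sub
    ((hasDerivAt_inv hL.ne').mul h₂)).const_mul (2 * π))
  refine (hS.congr_deriv ?_).congr_of_eventuallyEq (.of_forall fun M => Svac_eq_sub hg c M)
  rw [hsplit]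
  simp only [id]
  field_simp
  ring
end

section
/- Let β > 0 and λ₁, λ₂ ∈ ℝ with λ₁λ₂ ≠ 1, and set λ₁₂ = (λ₁ + λ₂)/(1 − λ₁λ₂). Let x ∈ ℝ be such that λ₂(e^{2πx/β} − 1) + 2π/β ≠ 0 and 1 + A_β(λ₂, x) > 0; set y = α_β(λ₂, x); assume further λ₁(e^{2πy/β} − 1) + 2π/β ≠ 0, 1 + A_β(λ₁, y) > 0, λ₁₂(e^{2πx/β} − 1) + 2π/β ≠ 0, and 1 + A_β(λ₁₂, x) > 0. Then α_β(λ₁, α_β(λ₂, x)) = α_β(λ₁₂, x), i.e. the thermal rotations form a one-parameter group under the tangent addition law. -/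
open Real

/-- The function `A_β(λ,x)` of the thermal rotation. -/
noncomputable def Abeta (β lam x : ℝ) : ℝ :=
  (2 * π / β) * (Real.exp (2 * π * x / β) - 1 - (2 * π / β) * lam) /
    (lam * (Real.exp (2 * π * x / β) - 1) + 2 * π / β)

/-- The thermal rotation `α_β(λ,x)`. -/
noncomputable def alphaBeta (β lam x : ℝ) : ℝ :=
  (β / (2 * π)) * Real.log (1 + Abeta β lam x)

/-- The Jacobian factor `Y_β(λ,x)` of the thermal rotation. -/
noncomputable def Ybeta (β lam x : ℝ) : ℝ :=
  4 * π ^ 2 * β * (lam ^ 2 + 1) * Real.exp (2 * π * x / β) /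
    ((β * lam * (Real.exp (2 * π * x / β) - 1) + 2 * π) *
      (β * (β * lam + 2 * π) * Real.exp (2 * π * x / β) - (β ^ 2 + 4 * π ^ 2) * lam))

/-- Exponentiating a thermal rotation recovers the argument of its logarithm. -/
theorem exp_alphaBeta {β lam x : ℝ} (hβ : β ≠ 0) (hpos : 0 < 1 + Abeta β lam x) :
    Real.exp (2 * π * alphaBeta β lam x / β) = 1 + Abeta β lam x := by
  have h : 2 * π * alphaBeta β lam x / β = Real.log (1 + Abeta β lam x) := by
    unfold alphaBeta
    field_simp
  rw [h, Real.exp_log hpos]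

/-- The Möbius maps `u ↦ c (u - c a) / (a u + c)` compose by the tangent addition law. -/
theorem tangent_comp {a b d c u : ℝ} (hab : 1 - a * b ≠ 0) (hd : d = (a + b) / (1 - a * b))
    (hb : b * u + c ≠ 0) (ha : a * (c * (u - c * b) / (b * u + c)) + c ≠ 0)
    (hdu : d * u + c ≠ 0) :
    c * (c * (u - c * b) / (b * u + c) - c * a) / (a * (c * (u - c * b) / (b * u + c)) + c) =
      c * (u - c * d) / (d * u + c) := by
  have hd' : d * (1 - a * b) = a + b := by
    rw [hd, div_mul_cancel₀ _ hab]
  have hv := div_mul_cancel₀ (c * (u - c * b)) hb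
  generalize c * (u - c * b) / (b * u + c) = v at *
  rw [div_eq_div_iff ha hdu]
  linear_combination c * (1 + a * d) * hv + c * (v * u + c ^ 2) * hd'

theorem stmt3 (β : ℝ) (hβ : 0 < β) (lam₁ lam₂ : ℝ) (h12 : lam₁ * lam₂ ≠ 1)
    (lam₁₂ : ℝ) (hlam₁₂ : lam₁₂ = (lam₁ + lam₂) / (1 - lam₁ * lam₂))
    (x : ℝ)
    (hden₂ : lam₂ * (Real.exp (2 * π * x / β) - 1) + 2 * π / β ≠ 0)
    (hpos₂ : 0 < 1 + Abeta β lam₂ x)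
    (y : ℝ) (hy : y = alphaBeta β lam₂ x)
    (hden₁ : lam₁ * (Real.exp (2 * π * y / β) - 1) + 2 * π / β ≠ 0)
    (hpos₁ : 0 < 1 + Abeta β lam₁ y)
    (hden₁₂ : lam₁₂ * (Real.exp (2 * π * x / β) - 1) + 2 * π / β ≠ 0)
    (hpos₁₂ : 0 < 1 + Abeta β lam₁₂ x) :
    alphaBeta β lam₁ (alphaBeta β lam₂ x) = alphaBeta β lam₁₂ x := by
  have hdiff : 1 - lam₁ * lam₂ ≠ 0 := sub_ne_zero.mpr h12.symm
  rw [← hy]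
  rw [hy, exp_alphaBeta hβ.ne' hpos₂] at hden₁
  unfold alphaBeta
  congr 3
  rw [Abeta, hy, exp_alphaBeta hβ.ne' hpos₂]
  rw [add_sub_cancel_left] at hden₁ ⊢
  unfold Abeta at hden₁ ⊢
  rw [mul_div_assoc 2 π β] at *
  generalize Real.exp (2 * π * x / β) - 1 = u at *
  have hc : 2 * (π / β) ≠ 0 := mul_ne_zero two_ne_zero (div_ne_zero pi_ne_zero hβ.ne')
  generalize 2 * (π / β) = c at *
  exact tangent_comp hdiff hlam₁₂ hden₂ hden₁ hden₁₂
end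

section
/- Let f, g : ℝ → ℝ be smooth compactly supported functions, and for p ∈ ℝ let f̂(p) = ∫_ℝ e^{ixp} f(x) dx and ĝ(p) = ∫_ℝ e^{ixp} g(x) dx. Then ∫_ℝ f(x)·g'(x) dx = (1/π)·∫_0^∞ Im( conj(f̂(p))·ĝ(p) )·p dp. -/
open Real MeasureTheory

/-- For real `f`, the transform with kernel `exp (i x p)` at `-p` is the conjugate of that at `p`. -/
theorem integral_exp_mul_ofReal_neg (f : ℝ → ℝ) (p : ℝ) :
    ∫ x : ℝ, Complex.exp (Complex.I * x * (-p : ℝ)) * f x =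
      (starRingEnd ℂ) (∫ x : ℝ, Complex.exp (Complex.I * x * p) * f x) := by
  rw [← integral_conj]
  congr 1 with x
  simp [← Complex.exp_conj]

open FourierTransform in
theorem fourier_ofReal_eq_conj_integral_exp (f : ℝ → ℝ) (w : ℝ) :
    𝓕 (fun x : ℝ ↦ (f x : ℂ)) w =
      (starRingEnd ℂ) (∫ x : ℝ, Complex.exp (Complex.I * x * (2 * π * w : ℝ)) * f x) := by
  rw [Real.fourier_real_eq_integral_exp_smul, ← integral_exp_mul_ofReal_neg]
  congr 1 with x
  rw [smul_eq_mul]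
  congr 2
  push_cast
  ring

open FourierTransform in
/-- Plancherel's theorem for a test function and the derivative of another one, together with
integrability of the frequency-side integrand. -/
theorem integrable_and_integral_conj_fourier_mul_fourier_deriv {F G : ℝ → ℂ}
    (hF : ContDiff ℝ (⊤ : ℕ∞) F) (hFc : HasCompactSupport F)
    (hG : ContDiff ℝ (⊤ : ℕ∞) G) (hGc : HasCompactSupport G) :
    Integrable (fun w : ℝ ↦ (starRingEnd ℂ) (𝓕 F w) * ((2 * π * Complex.I * w) * 𝓕 G w)) ∧
    ∫ w : ℝ, (starRingEnd ℂ) (𝓕 F w) * ((2 * π * Complex.I * w) * 𝓕 G w) =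
      ∫ x : ℝ, (starRingEnd ℂ) (F x) * deriv G x := by
  let F' := hFc.toSchwartzMap hF
  let G' := hGc.toSchwartzMap hG
  have h := SchwartzMap.integral_inner_fourier_fourier F' (SchwartzMap.derivCLM ℂ ℂ G')
  have hd : 𝓕 (deriv G) = fun w : ℝ ↦ (2 * π * Complex.I * w) • 𝓕 G w :=
    Real.fourier_deriv G'.integrable G'.differentiable
      (SchwartzMap.derivCLM ℂ ℂ G').integrable
  have hF' : ∀ w, 𝓕 F' w = 𝓕 F w := fun w ↦ by rw [SchwartzMap.fourier_coe]; rfl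
  have hG' : ∀ w, 𝓕 (SchwartzMap.derivCLM ℂ ℂ G') w = (2 * π * Complex.I * w) * 𝓕 G w :=
    fun w ↦ by
      rw [SchwartzMap.fourier_coe, ← smul_eq_mul]
      exact congrFun hd w
  have hint : Integrable fun w ↦
      (starRingEnd ℂ) (𝓕 F' w) * 𝓕 (SchwartzMap.derivCLM ℂ ℂ G') w :=
    ((𝓕 F').memLp 2).star.integrable_mul ((𝓕 (SchwartzMap.derivCLM ℂ ℂ G')).memLp 2)
  simp_rw [hF', hG', RCLike.inner_apply'] at h
  simp_rw [hF', hG'] at hint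
  exact ⟨hint, h⟩

open FourierTransform in
theorem stmt4 (f g : ℝ → ℝ)
    (hf : ContDiff ℝ (⊤ : ℕ∞) f) (hfc : HasCompactSupport f)
    (hg : ContDiff ℝ (⊤ : ℕ∞) g) (hgc : HasCompactSupport g) :
    ∫ x : ℝ, f x * deriv g x =
      (1 / π) * ∫ p in Set.Ioi (0 : ℝ),
        ((starRingEnd ℂ) (∫ x : ℝ, Complex.exp (Complex.I * x * p) * f x) *
            (∫ x : ℝ, Complex.exp (Complex.I * x * p) * g x)).im * p := by
  set H : ℝ → ℝ := fun p ↦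
    ((starRingEnd ℂ) (∫ x : ℝ, Complex.exp (Complex.I * x * p) * f x) *
      (∫ x : ℝ, Complex.exp (Complex.I * x * p) * g x)).im * p with hH
  have hF : ContDiff ℝ (⊤ : ℕ∞) (fun x ↦ (f x : ℂ)) := Complex.ofRealCLM.contDiff.comp hf
  have hG : ContDiff ℝ (⊤ : ℕ∞) (fun x ↦ (g x : ℂ)) := Complex.ofRealCLM.contDiff.comp hg
  have hFc : HasCompactSupport (fun x ↦ (f x : ℂ)) := hfc.comp_left Complex.ofReal_zero
  have hGc : HasCompactSupport (fun x ↦ (g x : ℂ)) := hgc.comp_left Complex.ofReal_zero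
  obtain ⟨hint, hpl⟩ := integrable_and_integral_conj_fourier_mul_fourier_deriv hF hFc hG hGc
  have hdg : ∀ x, deriv (fun y ↦ (g y : ℂ)) x = (deriv g x : ℝ) := fun x ↦
    ((hg.differentiable (by simp)) x).hasDerivAt.ofReal_comp.deriv
  simp_rw [hdg, Complex.conj_ofReal, ← Complex.ofReal_mul, integral_complex_ofReal] at hpl
  have hre : ∫ w : ℝ, H (2 * π * w) = ∫ x : ℝ, f x * deriv g x := by
    rw [← Complex.ofReal_re (∫ x : ℝ, f x * deriv g x), ← hpl]
    refine Eq.trans ?_ (integral_re hint)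
    congr 1 with w
    rw [fourier_ofReal_eq_conj_integral_exp, fourier_ofReal_eq_conj_integral_exp, hH]
    simp
    ring
  have heven : ∀ p, H |p| = H p := fun p ↦ by
    rcases abs_choice p with h | h <;> rw [h]
    simp only [hH]
    rw [integral_exp_mul_ofReal_neg, integral_exp_mul_ofReal_neg]
    simp
    ring
  have habs := integral_comp_abs (f := H)
  simp_rw [heven] at habs
  rw [Measure.integral_comp_mul_left, habs, abs_of_pos (by positivity), smul_eq_mul] at hre
  rw [← hre]
  field_simp
end

section
/- Let β > 0, λ ∈ ℝ, and x ∈ ℝ be such that λ(e^{2πx/β} − 1) + 2π/β ≠ 0 and 1 + A_β(λ,x) > 0. Then the partial derivative in x of α_β(λ,x) exists and equals Y_β(λ,x) = 4π²β(λ² + 1)e^{2πx/β} / [ (βλ(e^{2πx/β} − 1) + 2π)·(β(βλ + 2π)e^{2πx/β} − (β² + 4π²)λ) ]. -/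
open Real

theorem hasDerivAt_Abeta (β lam x : ℝ)
    (hden : lam * (Real.exp (2 * π * x / β) - 1) + 2 * π / β ≠ 0) :
    HasDerivAt (Abeta β lam)
      ((2 * π / β) ^ 3 * (lam ^ 2 + 1) * Real.exp (2 * π * x / β) /
        (lam * (Real.exp (2 * π * x / β) - 1) + 2 * π / β) ^ 2) x := by
  have hexp : HasDerivAt (fun y => Real.exp (2 * π * y / β))
      (Real.exp (2 * π * x / β) * (2 * π * 1 / β)) x :=
    (((hasDerivAt_id x).const_mul (2 * π)).div_const β).exp
  have hnum := ((hexp.sub_const 1).sub_const (2 * π / β * lam)).const_mul (2 * π / β)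
  have hdenom := ((hexp.sub_const 1).const_mul lam).add_const (2 * π / β)
  refine (hnum.div hdenom hden).congr_deriv ?_
  congr 1
  ring

theorem one_add_Abeta (β lam x : ℝ)
    (hden : lam * (Real.exp (2 * π * x / β) - 1) + 2 * π / β ≠ 0) :
    1 + Abeta β lam x =
      ((lam + 2 * π / β) * Real.exp (2 * π * x / β) - (1 + (2 * π / β) ^ 2) * lam) /
        (lam * (Real.exp (2 * π * x / β) - 1) + 2 * π / β) := by
  rw [Abeta, eq_div_iff hden, add_mul, div_mul_cancel₀ _ hden]
  ring

theorem stmt5 (β : ℝ) (hβ : 0 < β) (lam x : ℝ)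
    (hden : lam * (Real.exp (2 * π * x / β) - 1) + 2 * π / β ≠ 0)
    (hpos : 0 < 1 + Abeta β lam x) :
    HasDerivAt (fun y => alphaBeta β lam y) (Ybeta β lam x) x := by
  have hlog := (((hasDerivAt_Abeta β lam x hden).const_add 1).log hpos.ne').const_mul
    (β / (2 * π))
  refine hlog.congr_deriv ?_
  have hne := hpos.ne'
  rw [one_add_Abeta β lam x hden] at hne ⊢
  have hnum := (div_ne_zero_iff.mp hne).1
  have hβ0 := hβ.ne'
  have hπ := Real.pi_ne_zero
  rw [Ybeta]
  generalize Real.exp (2 * π * x / β) = E at *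
  have hfst : β * lam * (E - 1) + 2 * π = β * (lam * (E - 1) + 2 * π / β) := by
    field_simp
  have hsnd : β * (β * lam + 2 * π) * E - (β ^ 2 + 4 * π ^ 2) * lam =
      β ^ 2 * ((lam + 2 * π / β) * E - (1 + (2 * π / β) ^ 2) * lam) := by
    field_simp
    ring
  rw [hfst, hsnd]
  generalize lam * (E - 1) + 2 * π / β = D at *
  generalize (lam + 2 * π / β) * E - (1 + (2 * π / β) ^ 2) * lam = N at *
  field_simp
  ring
end

section
/- Let φ₁₊, φ₁₋, φ₂₊, φ₂₋ : ℝ → ℝ be smooth compactly supported functions, and for i = 1, 2 define f_i(x) = φ_{i+}(x) + φ_{i−}(−x) and g_i(x) = φ_{i+}'(x) + φ_{i−}'(−x). Then (1/2)·∫_ℝ ( g₁(x)·f₂(x) − f₁(x)·g₂(x) ) dx = −∫_ℝ ( φ_{1+}(x)·φ_{2+}'(x) + φ_{1−}(x)·φ_{2−}'(x) ) dx. -/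
open Real MeasureTheory

/-- The derivative of a compactly supported `C¹` function on `ℝ` has integral zero. -/
theorem integral_deriv_eq_zero_of_hasCompactSupport {F : ℝ → ℝ} (hF : ContDiff ℝ 1 F)
    (hc : HasCompactSupport F) : ∫ x, deriv F x = 0 :=
  integral_eq_zero_of_hasDerivAt_of_integrable
    (fun x => ((hF.differentiable one_ne_zero) x).hasDerivAt)
    (hF.continuous_deriv_one.integrable_of_hasCompactSupport hc.deriv)
    (hF.continuous.integrable_of_hasCompactSupport hc)

/-- The chiral symplectic density of a compactly supported continuous function and a `C¹` function
is integrable. -/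
theorem integrable_mul_deriv_of_hasCompactSupport {u v : ℝ → ℝ} (hu : Continuous u)
    (hv : ContDiff ℝ 1 v) (hc : HasCompactSupport u) : Integrable (fun x => u x * deriv v x) :=
  (hu.mul hv.continuous_deriv_one).integrable_of_hasCompactSupport hc.mul_right

theorem stmt8 (φ₁p φ₁m φ₂p φ₂m : ℝ → ℝ)
    (h₁p : ContDiff ℝ (⊤ : ℕ∞) φ₁p) (hc₁p : HasCompactSupport φ₁p)
    (h₁m : ContDiff ℝ (⊤ : ℕ∞) φ₁m) (hc₁m : HasCompactSupport φ₁m)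
    (h₂p : ContDiff ℝ (⊤ : ℕ∞) φ₂p) (hc₂p : HasCompactSupport φ₂p)
    (h₂m : ContDiff ℝ (⊤ : ℕ∞) φ₂m) (hc₂m : HasCompactSupport φ₂m) :
    (1 / 2) * ∫ x : ℝ,
        ((deriv φ₁p x + deriv φ₁m (-x)) * (φ₂p x + φ₂m (-x)) -
          (φ₁p x + φ₁m (-x)) * (deriv φ₂p x + deriv φ₂m (-x))) =
      -∫ x : ℝ, (φ₁p x * deriv φ₂p x + φ₁m x * deriv φ₂m x) := by
  have h1 : (1 : WithTop ℕ∞) ≤ ((⊤ : ℕ∞) : WithTop ℕ∞) := by exact_mod_cast le_top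
  replace h₁p := h₁p.of_le h1
  replace h₁m := h₁m.of_le h1
  replace h₂p := h₂p.of_le h1
  replace h₂m := h₂m.of_le h1
  have hasDeriv_neg {u : ℝ → ℝ} (hu : ContDiff ℝ 1 u) (x : ℝ) :
      HasDerivAt (fun y => u (-y)) (-deriv u (-x)) x := by
    simpa [Function.comp_def] using
      ((hu.differentiable one_ne_zero) (-x)).hasDerivAt.comp x (hasDerivAt_neg x)
  have compact_neg {u : ℝ → ℝ} (hu : HasCompactSupport u) :
      HasCompactSupport (fun y => u (-y)) :=
    hu.comp_homeomorph (Homeomorph.neg ℝ)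
  -- The integrand is `deriv F` minus twice the sum of the two chiral densities.
  let F : ℝ → ℝ := fun x => (φ₁p x - φ₁m (-x)) * (φ₂p x + φ₂m (-x))
  have hF : ContDiff ℝ 1 F :=
    (h₁p.sub (h₁m.comp contDiff_neg)).mul (h₂p.add (h₂m.comp contDiff_neg))
  have hFc : HasCompactSupport F :=
    HasCompactSupport.mul_left (hc₂p.add (compact_neg hc₂m))
  have hF' (x : ℝ) : deriv F x =
      (deriv φ₁p x + deriv φ₁m (-x)) * (φ₂p x + φ₂m (-x)) +
        (φ₁p x - φ₁m (-x)) * (deriv φ₂p x - deriv φ₂m (-x)) := by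
    have h := ((((h₁p.differentiable one_ne_zero) x).hasDerivAt.sub (hasDeriv_neg h₁m x)).mul
      (((h₂p.differentiable one_ne_zero) x).hasDerivAt.add (hasDeriv_neg h₂m x))).deriv
    refine Eq.trans h ?_
    simp only [Pi.sub_apply, Pi.add_apply]
    ring
  have hFi : Integrable (deriv F) :=
    hF.continuous_deriv_one.integrable_of_hasCompactSupport hFc.deriv
  have hp := integrable_mul_deriv_of_hasCompactSupport h₁p.continuous h₂p hc₁p
  have hm := integrable_mul_deriv_of_hasCompactSupport h₁m.continuous h₂m hc₁m
  have hm' : Integrable (fun x => φ₁m (-x) * deriv φ₂m (-x)) := hm.comp_neg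
  have split : ∀ x : ℝ,
      (deriv φ₁p x + deriv φ₁m (-x)) * (φ₂p x + φ₂m (-x)) -
          (φ₁p x + φ₁m (-x)) * (deriv φ₂p x + deriv φ₂m (-x)) =
        deriv F x - 2 * (φ₁p x * deriv φ₂p x + φ₁m (-x) * deriv φ₂m (-x)) := by
    intro x
    rw [hF']
    ring
  have hpm : Integrable (fun x => φ₁p x * deriv φ₂p x + φ₁m (-x) * deriv φ₂m (-x)) :=
    hp.add hm'
  simp_rw [split]
  rw [integral_sub hFi (hpm.const_mul 2), integral_const_mul, integral_add hp hm',
    integral_add hp hm, integral_deriv_eq_zero_of_hasCompactSupport hF hFc,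
    integral_neg_eq_self (fun x => φ₁m x * deriv φ₂m x) volume]
  ring
end

section
/- Let β > 0, a < b, and for u ∈ ℝ and x ∈ [a,b] define N(u,x) = sinh(πu)·e^{π(a+b−x)/β} − sinh(π(b−a)/β + πu)·e^{πx/β} and D(u,x) = −sinh(πu)·e^{−π(a+b−x)/β} + sinh(πu − π(b−a)/β)·e^{−πx/β}, and ψ^β_u(x) = (β/2π)·log( N(u,x)/D(u,x) ). Then: (i) N(u,x)/D(u,x) > 0 for all u ∈ ℝ and x ∈ [a,b], so ψ^β_u is well defined; (ii) ψ^β_0(x) = x for all x ∈ [a,b]; (iii) ψ^β_u(a) = a and ψ^β_u(b) = b for all u ∈ ℝ. -/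
open Real

/-- Numerator of the argument of the thermal modular flow of the interval `(a,b)`. -/
noncomputable def Nflow (β a b u x : ℝ) : ℝ :=
  Real.sinh (π * u) * Real.exp (π * (a + b - x) / β) -
    Real.sinh (π * (b - a) / β + π * u) * Real.exp (π * x / β)

/-- Denominator of the argument of the thermal modular flow of the interval `(a,b)`. -/
noncomputable def Dflow (β a b u x : ℝ) : ℝ :=
  -Real.sinh (π * u) * Real.exp (-(π * (a + b - x) / β)) +
    Real.sinh (π * u - π * (b - a) / β) * Real.exp (-(π * x / β))

/-- Geometric action of the thermal modular flow of the interval `(a,b)` at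
inverse temperature `β`. -/
noncomputable def psiBetaFlow (β a b u x : ℝ) : ℝ :=
  (β / (2 * π)) * Real.log (Nflow β a b u x / Dflow β a b u x)

theorem Nflow_eq (β a b u x : ℝ) :
    Nflow β a b u x =
      -(exp (π * a / β - π * u) * sinh (π * b / β - π * x / β) +
        exp (π * b / β + π * u) * sinh (π * x / β - π * a / β)) := by
  have h₁ : π * (a + b - x) / β = π * a / β + π * b / β - π * x / β := by ring
  have h₂ : π * (b - a) / β = π * b / β - π * a / β := by ring
  rw [Nflow, h₁, h₂]
  generalize π * a / β = A, π * b / β = B, π * x / β = X, π * u = s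
  simp only [sinh_eq, exp_add, exp_sub, exp_neg]
  field_simp
  ring

theorem Dflow_eq (β a b u x : ℝ) :
    Dflow β a b u x =
      -(exp (-(π * a / β) - π * u) * sinh (π * b / β - π * x / β) +
        exp (-(π * b / β) + π * u) * sinh (π * x / β - π * a / β)) := by
  have h₁ : π * (a + b - x) / β = π * a / β + π * b / β - π * x / β := by ring
  have h₂ : π * (b - a) / β = π * b / β - π * a / β := by ring
  rw [Dflow, h₁, h₂]
  generalize π * a / β = A, π * b / β = B, π * x / β = X, π * u = s
  simp only [sinh_eq, exp_add, exp_sub, exp_neg]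
  field_simp
  ring

theorem exp_mul_sinh_add_exp_mul_sinh_pos {A B X : ℝ} (p q : ℝ) (hAB : A < B)
    (hA : A ≤ X) (hB : X ≤ B) : 0 < exp p * sinh (B - X) + exp q * sinh (X - A) := by
  rcases hA.eq_or_lt with rfl | hA
  · simpa using mul_pos (exp_pos p) (sinh_pos_iff.2 (sub_pos.2 hAB))
  · exact add_pos_of_nonneg_of_pos
      (mul_nonneg (exp_pos p).le (sinh_nonneg_iff.2 (sub_nonneg.2 hB)))
      (mul_pos (exp_pos q) (sinh_pos_iff.2 (sub_pos.2 hA)))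

theorem Dflow_neg {β a b : ℝ} (hβ : 0 < β) (hab : a < b) (u : ℝ) {x : ℝ}
    (hx : x ∈ Set.Icc a b) : Dflow β a b u x < 0 := by
  obtain ⟨hxa, hxb⟩ := hx
  rw [Dflow_eq, neg_lt_zero]
  apply exp_mul_sinh_add_exp_mul_sinh_pos <;> gcongr

theorem Nflow_neg {β a b : ℝ} (hβ : 0 < β) (hab : a < b) (u : ℝ) {x : ℝ}
    (hx : x ∈ Set.Icc a b) : Nflow β a b u x < 0 := by
  obtain ⟨hxa, hxb⟩ := hx
  rw [Nflow_eq, neg_lt_zero]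
  apply exp_mul_sinh_add_exp_mul_sinh_pos <;> gcongr

theorem psiBetaFlow_eq_self {β a b u x : ℝ} (hβ : 0 < β) (hD : Dflow β a b u x ≠ 0)
    (h : Nflow β a b u x = exp (2 * (π * x / β)) * Dflow β a b u x) :
    psiBetaFlow β a b u x = x := by
  rw [psiBetaFlow, h, mul_div_cancel_right₀ _ hD, log_exp]
  field_simp

theorem stmt12 (β a b : ℝ) (hβ : 0 < β) (hab : a < b) :
    (∀ u : ℝ, ∀ x ∈ Set.Icc a b, 0 < Nflow β a b u x / Dflow β a b u x) ∧
    (∀ x ∈ Set.Icc a b, psiBetaFlow β a b 0 x = x) ∧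
    (∀ u : ℝ, psiBetaFlow β a b u a = a ∧ psiBetaFlow β a b u b = b) := by
  refine ⟨fun u x hx => div_pos_of_neg_of_neg (Nflow_neg hβ hab u hx) (Dflow_neg hβ hab u hx),
    fun x hx => psiBetaFlow_eq_self hβ (Dflow_neg hβ hab 0 hx).ne ?_,
    fun u => ⟨psiBetaFlow_eq_self hβ (Dflow_neg hβ hab u ⟨le_rfl, hab.le⟩).ne ?_,
      psiBetaFlow_eq_self hβ (Dflow_neg hβ hab u ⟨hab.le, le_rfl⟩).ne ?_⟩⟩
  · have h : π * x / β = 2 * (π * x / β) + -(π * x / β) := by ring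
    simp only [Nflow, Dflow, mul_zero, sinh_zero, zero_mul, neg_zero, zero_sub, zero_add, add_zero,
      sinh_neg]
    conv_lhs => rw [h, exp_add]
    ring
  · have h : π * a / β - π * u = 2 * (π * a / β) + (-(π * a / β) - π * u) := by ring
    rw [Nflow_eq, Dflow_eq, h, exp_add, sub_self, sinh_zero]
    ring
  · have h : π * b / β + π * u = 2 * (π * b / β) + (-(π * b / β) + π * u) := by ring
    rw [Nflow_eq, Dflow_eq, h, exp_add, sub_self, sinh_zero]
    ring
end

section
/- Let β > 0, a < b, x ∈ (a,b), and define ψ^β_u(x) = (β/2π)·log( ( sinh(πu)·e^{π(a+b−x)/β} − sinh(π(b−a)/β + πu)·e^{πx/β} ) / ( −sinh(πu)·e^{−π(a+b−x)/β} + sinh(πu − π(b−a)/β)·e^{−πx/β} ) ). Then u ↦ ψ^β_u(x) is differentiable at u = 0 and d/du ψ^β_u(x) |_{u=0} = 2β·sinh(π(x−a)/β)·sinh(π(b−x)/β)/sinh(π(b−a)/β). -/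
open Real

/-- Derivative of the numerator of the thermal flow at `u = 0`. -/
theorem hasDerivAt_Nflow_zero (β a b x : ℝ) :
    HasDerivAt (fun u => Nflow β a b u x)
      (π * (Real.exp (π * (a + b - x) / β) -
        Real.cosh (π * (b - a) / β) * Real.exp (π * x / β))) 0 := by
  have hu : HasDerivAt (fun u : ℝ => π * u) π 0 := by
    simpa using (hasDerivAt_id (0 : ℝ)).const_mul π
  have h := (hu.sinh.mul_const (Real.exp (π * (a + b - x) / β))).sub
    ((hu.const_add (π * (b - a) / β)).sinh.mul_const (Real.exp (π * x / β)))
  refine h.congr_deriv ?_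
  simp only [mul_zero, add_zero, Real.cosh_zero]
  ring

/-- Derivative of the denominator of the thermal flow at `u = 0`. -/
theorem hasDerivAt_Dflow_zero (β a b x : ℝ) :
    HasDerivAt (fun u => Dflow β a b u x)
      (π * (-Real.exp (-(π * (a + b - x) / β)) +
        Real.cosh (π * (b - a) / β) * Real.exp (-(π * x / β)))) 0 := by
  have hu : HasDerivAt (fun u : ℝ => π * u) π 0 := by
    simpa using (hasDerivAt_id (0 : ℝ)).const_mul π
  have h := (hu.sinh.neg.mul_const (Real.exp (-(π * (a + b - x) / β)))).add
    ((hu.sub_const (π * (b - a) / β)).sinh.mul_const (Real.exp (-(π * x / β))))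
  refine h.congr_deriv ?_
  simp only [mul_zero, zero_sub, Real.cosh_zero, Real.cosh_neg]
  ring

theorem Nflow_zero (β a b x : ℝ) :
    Nflow β a b 0 x = -(Real.sinh (π * (b - a) / β) * Real.exp (π * x / β)) := by
  simp [Nflow]

theorem Dflow_zero (β a b x : ℝ) :
    Dflow β a b 0 x = -(Real.sinh (π * (b - a) / β) * Real.exp (-(π * x / β))) := by
  simp [Dflow]

theorem cosh_add_sub_cosh_sub (p q : ℝ) :
    Real.cosh (p + q) - Real.cosh (p - q) = 2 * Real.sinh p * Real.sinh q := by
  rw [Real.cosh_add, Real.cosh_sub]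
  ring

theorem stmt13 (β a b : ℝ) (hβ : 0 < β) (hab : a < b)
    (x : ℝ) (hx : x ∈ Set.Ioo a b) :
    HasDerivAt (fun u => psiBetaFlow β a b u x)
      (2 * β * Real.sinh (π * (x - a) / β) * Real.sinh (π * (b - x) / β) /
        Real.sinh (π * (b - a) / β)) 0 := by
  have hS : Real.sinh (π * (b - a) / β) ≠ 0 :=
    (Real.sinh_pos_iff.2 (div_pos (mul_pos pi_pos (sub_pos.2 hab)) hβ)).ne'
  have hN : Nflow β a b 0 x ≠ 0 := by
    rw [Nflow_zero]
    exact neg_ne_zero.2 (mul_ne_zero hS (Real.exp_pos _).ne')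
  have hD : Dflow β a b 0 x ≠ 0 := by
    rw [Dflow_zero]
    exact neg_ne_zero.2 (mul_ne_zero hS (Real.exp_pos _).ne')
  have h := (((hasDerivAt_Nflow_zero β a b x).div (hasDerivAt_Dflow_zero β a b x) hD).log
    (div_ne_zero hN hD)).const_mul (β / (2 * π))
  refine h.congr_deriv ?_
  have hsum : π * (b - a) / β = π * (b - x) / β + π * (x - a) / β := by ring
  have hexp : π * (a + b - x) / β =
      π * x / β + (π * (b - x) / β - π * (x - a) / β) := by ring
  have key := cosh_add_sub_cosh_sub (π * (b - x) / β) (π * (x - a) / β)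
  rw [← hsum, Real.cosh_eq (π * (b - x) / β - π * (x - a) / β)] at key
  simp only [Pi.div_apply]
  rw [Nflow_zero, Dflow_zero, hexp, neg_add, Real.exp_add, Real.exp_add]
  rw [Real.exp_neg] at key
  rw [Real.exp_neg, Real.exp_neg]
  have hX := (Real.exp_pos (π * x / β)).ne'
  have hE := (Real.exp_pos (π * (b - x) / β - π * (x - a) / β)).ne'
  have hπ := pi_pos.ne'
  generalize Real.exp (π * (b - x) / β - π * (x - a) / β) = E at *
  generalize Real.exp (π * x / β) = X at *
  generalize Real.sinh (π * (b - a) / β) = S at *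
  generalize Real.cosh (π * (b - a) / β) = C at *
  generalize Real.sinh (π * (b - x) / β) = P at *
  generalize Real.sinh (π * (x - a) / β) = Q at *
  have hpq : 2 * β * Q * P / S = β * (C - (E + E⁻¹) / 2) / S := by rw [key]; ring
  rw [hpq]
  field_simp
  ring
end

section
/- Let a < b, set L = b − a, and let f : ℝ → ℝ be continuously differentiable. Then 2π·∫_a^b ((x − a)(b − x)/(b − a))·f'(x)² dx ≤ (πL/2)·∫_a^b f'(x)² dx. -/
open Real intervalIntegral

theorem stmt16 (a b : ℝ) (hab : a < b) (f : ℝ → ℝ) (hf : ContDiff ℝ 1 f) :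
    2 * π * ∫ x in a..b, ((x - a) * (b - x) / (b - a)) * (deriv f x) ^ 2 ≤
      (π * (b - a) / 2) * ∫ x in a..b, (deriv f x) ^ 2 := by
  have hc : Continuous (deriv f) := hf.continuous_deriv le_rfl
  rw [← integral_const_mul, ← integral_const_mul]
  refine integral_mono_on hab.le ?_ ?_ fun x _ => ?_
  · exact Continuous.intervalIntegrable (by fun_prop) _ _
  · exact Continuous.intervalIntegrable (by fun_prop) _ _
  · have hL : 0 < b - a := sub_pos.2 hab
    have hw : (x - a) * (b - x) / (b - a) ≤ (b - a) / 4 := by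
      rw [div_le_iff₀ hL]
      nlinarith [sq_nonneg (2 * x - a - b)]
    calc 2 * π * ((x - a) * (b - x) / (b - a) * deriv f x ^ 2)
        ≤ 2 * π * ((b - a) / 4 * deriv f x ^ 2) := by gcongr
      _ = π * (b - a) / 2 * deriv f x ^ 2 := by ring
end

section
/- Let β > 0, a < b, set L = b − a, and let f : ℝ → ℝ be continuously differentiable. Then 2β·∫_a^b ( sinh(π(x−a)/β)·sinh(π(b−x)/β)/sinh(π(b−a)/β) )·f'(x)² dx ≤ β·tanh(πL/(2β))·∫_a^b f'(x)² dx ≤ (πL/2)·∫_a^b f'(x)² dx. -/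
open Real intervalIntegral

theorem tanh_le_self_of_nonneg {s : ℝ} (hs : 0 ≤ s) : Real.tanh s ≤ s := by
  rw [Real.tanh_eq_sinh_div_cosh, div_le_iff₀ (Real.cosh_pos s)]
  have hder : ∀ x : ℝ, HasDerivAt (fun t : ℝ => t * Real.cosh t - Real.sinh t)
      (x * Real.sinh x) x := fun x =>
    (((hasDerivAt_id' x).mul (Real.hasDerivAt_cosh x)).sub (Real.hasDerivAt_sinh x)).congr_deriv
      (by ring)
  have hmono : MonotoneOn (fun t : ℝ => t * Real.cosh t - Real.sinh t) (Set.Ici 0) := by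
    refine monotoneOn_of_deriv_nonneg (convex_Ici 0)
      (fun x _ => (hder x).continuousAt.continuousWithinAt)
      (fun x _ => (hder x).differentiableAt.differentiableWithinAt) fun x hx => ?_
    rw [interior_Ici] at hx
    rw [(hder x).deriv]
    exact mul_nonneg hx.le (Real.sinh_nonneg_iff.2 hx.le)
  have h := hmono Set.self_mem_Ici hs hs
  simp only [zero_mul, Real.sinh_zero, sub_zero] at h
  linarith

theorem sinh_mul_sinh_div_sinh_add_le {u v : ℝ} (h : 0 < u + v) :
    Real.sinh u * Real.sinh v / Real.sinh (u + v) ≤ Real.tanh ((u + v) / 2) / 2 := by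
  obtain ⟨s, d, rfl, rfl⟩ : ∃ s d : ℝ, u = s + d ∧ v = s - d :=
    ⟨(u + v) / 2, (u - v) / 2, by ring, by ring⟩
  have hs : 0 < s := by linarith
  have hsum : s + d + (s - d) = 2 * s := by ring
  have hhalf : 2 * s / 2 = s := by ring
  have hsinh := Real.sinh_pos_iff.2 hs
  have hcosh := Real.cosh_pos s
  rw [hsum, hhalf, Real.sinh_two_mul, Real.tanh_eq_sinh_div_cosh, Real.sinh_add, Real.sinh_sub,
    div_le_iff₀ (by positivity)]
  have hrhs : Real.sinh s / Real.cosh s / 2 * (2 * Real.sinh s * Real.cosh s) =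
      Real.sinh s ^ 2 := by
    field_simp
  rw [hrhs]
  nlinarith [sq_nonneg (Real.sinh d), Real.cosh_sq s, Real.cosh_sq d]

theorem stmt17 (β a b : ℝ) (hβ : 0 < β) (hab : a < b)
    (f : ℝ → ℝ) (hf : ContDiff ℝ 1 f) :
    2 * β * ∫ x in a..b,
        (Real.sinh (π * (x - a) / β) * Real.sinh (π * (b - x) / β) /
          Real.sinh (π * (b - a) / β)) * (deriv f x) ^ 2 ≤
      β * Real.tanh (π * (b - a) / (2 * β)) * ∫ x in a..b, (deriv f x) ^ 2 ∧
    β * Real.tanh (π * (b - a) / (2 * β)) * ∫ x in a..b, (deriv f x) ^ 2 ≤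
      (π * (b - a) / 2) * ∫ x in a..b, (deriv f x) ^ 2 := by
  have hcont : Continuous (deriv f) := hf.continuous_deriv le_rfl
  have hL : 0 < b - a := sub_pos.2 hab
  constructor
  · rw [← integral_const_mul, ← integral_const_mul]
    refine integral_mono_on hab.le (Continuous.intervalIntegrable (by fun_prop) _ _)
      (Continuous.intervalIntegrable (by fun_prop) _ _) fun x _ => ?_
    have hsum : π * (x - a) / β + π * (b - x) / β = π * (b - a) / β := by ring
    have hkernel := sinh_mul_sinh_div_sinh_add_le (u := π * (x - a) / β) (v := π * (b - x) / β)
      (by rw [hsum]; positivity)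
    have hhalf : π * (b - a) / β / 2 = π * (b - a) / (2 * β) := by
      rw [div_div, mul_comm β]
    rw [hsum, hhalf] at hkernel
    rw [← mul_assoc]
    refine mul_le_mul_of_nonneg_right ?_ (sq_nonneg _)
    nlinarith
  · refine mul_le_mul_of_nonneg_right ?_ (integral_nonneg hab.le fun x _ => sq_nonneg _)
    calc β * Real.tanh (π * (b - a) / (2 * β)) ≤ β * (π * (b - a) / (2 * β)) :=
          mul_le_mul_of_nonneg_left (tanh_le_self_of_nonneg (by positivity)) hβ.le
      _ = π * (b - a) / 2 := by field_simp
end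

section
/- Let f : ℝ → ℝ be smooth with compact support, let c ∈ ℝ, and for L > 0 set a = c − L/2, b = c + L/2, and S(L) = 2π·∫_a^b ((x − a)(b − x)/L)·f'(x)² dx. Then S is twice differentiable on (0,∞) and S''(L) = (π/2)·( f'(b)² + f'(a)² ) − (4π/L³)·∫_a^b (x − c)²·f'(x)² dx; in particular S''(L) ≥ −(4π/L³)·∫_a^b (x − c)²·f'(x)² dx. -/
open Real intervalIntegral

theorem hasDerivAt_integral_symm {h : ℝ → ℝ} (hh : Continuous h) (c L : ℝ) :
    HasDerivAt (fun M => ∫ x in (c - M / 2)..(c + M / 2), h x)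
      ((h (c + L / 2) + h (c - L / 2)) / 2) L := by
  have hF : ∀ u, HasDerivAt (fun v => ∫ x in (0 : ℝ)..v, h x) (h u) u := fun u =>
    (hh.integral_hasStrictDerivAt 0 u).hasDerivAt
  have hb : HasDerivAt (fun M : ℝ => c + M / 2) (1 / 2) L :=
    ((hasDerivAt_id L).div_const 2).const_add c
  have ha : HasDerivAt (fun M : ℝ => c - M / 2) (-(1 / 2)) L :=
    ((hasDerivAt_id L).div_const 2).const_sub c
  have key := ((hF _).comp L hb).sub ((hF _).comp L ha)
  refine (key.congr_deriv (by ring)).congr_of_eventuallyEq (.of_forall fun M => ?_)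
  exact (integral_interval_sub_left (hh.intervalIntegrable _ _) (hh.intervalIntegrable _ _)).symm

theorem Svac_eq {f : ℝ → ℝ} (hf : Continuous (deriv f)) (c : ℝ) {L : ℝ} (hL : L ≠ 0) :
    Svac f c L = 2 * π * (L / 4 * (∫ x in (c - L / 2)..(c + L / 2), (deriv f x) ^ 2) -
      (∫ x in (c - L / 2)..(c + L / 2), (x - c) ^ 2 * (deriv f x) ^ 2) / L) := by
  rw [Svac, ← integral_const_mul (L / 4), ← integral_div, ← integral_sub
    (Continuous.intervalIntegrable (by fun_prop) _ _)
    (Continuous.intervalIntegrable (by fun_prop) _ _)]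
  congr 1
  refine integral_congr fun x _ => ?_
  field_simp
  ring

theorem hasDerivAt_Svac {f : ℝ → ℝ} (hf : Continuous (deriv f)) (c : ℝ) {L : ℝ} (hL : L ≠ 0) :
    HasDerivAt (fun M => Svac f c M)
      (2 * π * ((∫ x in (c - L / 2)..(c + L / 2), (deriv f x) ^ 2) / 4 +
        (∫ x in (c - L / 2)..(c + L / 2), (x - c) ^ 2 * (deriv f x) ^ 2) / L ^ 2)) L := by
  have hA := hasDerivAt_integral_symm (h := fun x => (deriv f x) ^ 2) (by fun_prop) c L
  have hB := hasDerivAt_integral_symm (h := fun x => (x - c) ^ 2 * (deriv f x) ^ 2)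
    (by fun_prop) c L
  have key := ((((hasDerivAt_id L).div_const 4).mul hA).sub
    (hB.div (hasDerivAt_id L) hL)).const_mul (2 * π)
  refine (key.congr_deriv ?_).congr_of_eventuallyEq ?_
  · simp only [id]
    field_simp
    ring
  · filter_upwards [isOpen_ne.mem_nhds hL] with M hM using Svac_eq hf c hM

theorem hasDerivAt_deriv_Svac {f : ℝ → ℝ} (hf : Continuous (deriv f)) (c : ℝ) {L : ℝ}
    (hL : L ≠ 0) :
    HasDerivAt (deriv (fun M => Svac f c M))
      ((π / 2) * ((deriv f (c + L / 2)) ^ 2 + (deriv f (c - L / 2)) ^ 2) -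
        (4 * π / L ^ 3) * ∫ x in (c - L / 2)..(c + L / 2), (x - c) ^ 2 * (deriv f x) ^ 2) L := by
  have hA := hasDerivAt_integral_symm (h := fun x => (deriv f x) ^ 2) (by fun_prop) c L
  have hB := hasDerivAt_integral_symm (h := fun x => (x - c) ^ 2 * (deriv f x) ^ 2)
    (by fun_prop) c L
  have key := ((hA.div_const 4).add
    (hB.div (hasDerivAt_pow 2 L) (pow_ne_zero 2 hL))).const_mul (2 * π)
  refine (key.congr_deriv ?_).congr_of_eventuallyEq ?_
  · field_simp
    ring
  · filter_upwards [isOpen_ne.mem_nhds hL] with M hM using (hasDerivAt_Svac hf c hM).deriv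

theorem stmt18 (f : ℝ → ℝ) (hf : ContDiff ℝ (⊤ : ℕ∞) f) (hfc : HasCompactSupport f)
    (c : ℝ) :
    ∀ L : ℝ, 0 < L →
      DifferentiableAt ℝ (fun M => Svac f c M) L ∧
      DifferentiableAt ℝ (deriv (fun M => Svac f c M)) L ∧
      deriv (deriv (fun M => Svac f c M)) L =
        (π / 2) * ((deriv f (c + L / 2)) ^ 2 + (deriv f (c - L / 2)) ^ 2) -
          (4 * π / L ^ 3) * ∫ x in (c - L / 2)..(c + L / 2),
            (x - c) ^ 2 * (deriv f x) ^ 2 ∧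
      deriv (deriv (fun M => Svac f c M)) L ≥
        -(4 * π / L ^ 3) * ∫ x in (c - L / 2)..(c + L / 2),
          (x - c) ^ 2 * (deriv f x) ^ 2 := by
  intro L hL
  have hd : Continuous (deriv f) := hf.continuous_deriv (by simp)
  have h2 := hasDerivAt_deriv_Svac hd c hL.ne'
  refine ⟨(hasDerivAt_Svac hd c hL.ne').differentiableAt, h2.differentiableAt, h2.deriv, ?_⟩
  rw [h2.deriv]
  have : 0 ≤ π / 2 * ((deriv f (c + L / 2)) ^ 2 + (deriv f (c - L / 2)) ^ 2) := by positivity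
  linarith
end
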